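/- arXiv:1511.02423 — 8 statements merged into one kernel-verified Lean document; each statement's English description precedes it below -/
import Mathlib

section
/- Let H be a symmetric n×n real matrix, f ∈ ℝⁿ, A ∈ ℝ^{m×n}, b ∈ ℝᵐ, and suppose F = {x ∈ ℝⁿ : Ax = b, x ≥ 0} is nonempty and bounded. Then the minimum of q(x) = ½·xᵀHx + fᵀx over F is attained, the set of KKT points of (QP) is nonempty, the minimum of ½·(fᵀx − bᵀμ) over all KKT points (x, μ, λ) is attained, and these two minima are equal. -/
open Matrix Filter Topology

/-- **Farkas' lemma**: a linear functional that is nonnegative wherever finitely many linear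
functionals are nonnegative is a nonnegative combination of them. -/
theorem exists_nonneg_combination_of_forall_nonneg {ι V : Type*} [AddCommGroup V] [Module ℝ V]
    (s : Finset ι) (a : ι → V →ₗ[ℝ] ℝ) (c : V →ₗ[ℝ] ℝ)
    (h : ∀ x, (∀ i ∈ s, 0 ≤ a i x) → 0 ≤ c x) :
    ∃ w : ι → ℝ, (∀ i, 0 ≤ w i) ∧ ∀ x, c x = ∑ i ∈ s, w i * a i x := by
  classical
  induction s using Finset.induction_on generalizing a c with
  | empty =>
    refine ⟨0, fun _ => le_rfl, fun x => ?_⟩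
    have h₁ := h x (by simp)
    have h₂ := h (-x) (by simp)
    rw [map_neg] at h₂
    simp only [Finset.sum_empty]
    linarith
  | insert k s hk ih =>
    by_cases hs : ∀ x, (∀ i ∈ s, 0 ≤ a i x) → 0 ≤ c x
    · obtain ⟨w, hw, hc⟩ := ih a c hs
      refine ⟨Function.update w k 0, fun i => ?_, fun x => ?_⟩
      · by_cases hi : i = k
        · simp [hi]
        · simpa [hi] using hw i
      · rw [Finset.sum_insert hk, hc x, Function.update_self, zero_mul, zero_add]
        refine Finset.sum_congr rfl fun i hi => ?_
        rw [Function.update_of_ne (ne_of_mem_of_not_mem hi hk)]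
    · push Not at hs
      obtain ⟨y, hy, hcy⟩ := hs
      have hky : a k y < 0 := by
        by_contra! hky
        exact hcy.not_ge (h y (by simpa [hky] using hy))
      obtain ⟨z, hz, hcz, hkz⟩ : ∃ z, (∀ i ∈ s, 0 ≤ a i z) ∧ c z < 0 ∧ a k z = -1 := by
        have hpos : 0 < (-(a k y))⁻¹ := inv_pos.mpr (neg_pos.mpr hky)
        refine ⟨(-(a k y))⁻¹ • y, fun i hi => ?_, ?_, ?_⟩
        · simpa only [map_smul, smul_eq_mul] using mul_nonneg hpos.le (hy i hi)
        · simpa only [map_smul, smul_eq_mul] using mul_neg_of_pos_of_neg hpos hcy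
        · rw [map_smul, smul_eq_mul]
          field_simp [hky.ne]
      let P : V →ₗ[ℝ] V := LinearMap.id + (a k).smulRight z
      have hP (φ : V →ₗ[ℝ] ℝ) (x : V) : (φ ∘ₗ P) x = φ x + a k x * φ z := by simp [P]
      obtain ⟨w, hw, hc⟩ := ih (fun i => a i ∘ₗ P) (c ∘ₗ P) fun x hx => by
        refine h (P x) fun i hi => ?_
        rcases Finset.mem_insert.mp hi with rfl | hi
        · have := hP (a i) x
          rw [hkz, mul_neg_one, add_neg_cancel] at this
          exact this.ge
        · exact hx i hi
      have hcoeff : 0 ≤ ∑ i ∈ s, w i * a i z - c z :=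
        sub_nonneg.mpr (hcz.le.trans (Finset.sum_nonneg fun i hi => mul_nonneg (hw i) (hz i hi)))
      refine ⟨Function.update w k (∑ i ∈ s, w i * a i z - c z), fun i => ?_, fun x => ?_⟩
      · by_cases hi : i = k
        · subst hi
          simpa using hcoeff
        · simpa [hi] using hw i
      · have hsum : ∑ i ∈ s, Function.update w k (∑ i ∈ s, w i * a i z - c z) i * a i x =
            ∑ i ∈ s, w i * a i x := Finset.sum_congr rfl fun i hi => by
          rw [Function.update_of_ne (ne_of_mem_of_not_mem hi hk)]
        have hcx := hc x
        simp only [hP, mul_add, Finset.sum_add_distrib] at hcx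
        have hfactor : ∑ i ∈ s, w i * (a k x * a i z) = a k x * ∑ i ∈ s, w i * a i z := by
          rw [Finset.mul_sum]
          exact Finset.sum_congr rfl fun i _ => by ring
        rw [Finset.sum_insert hk, hsum, Function.update_self]
        linarith

/-- Lagrange multipliers from the sign of a linear form on the cone of feasible directions. -/
theorem exists_multipliers_of_nonneg_on_feasible_directions {n m : ℕ}
    (A : Matrix (Fin m) (Fin n) ℝ) (g x : Fin n → ℝ)
    (h : ∀ d, A.mulVec d = 0 → (∀ i, x i = 0 → 0 ≤ d i) → 0 ≤ g ⬝ᵥ d) :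
    ∃ (μ : Fin m → ℝ) (lam : Fin n → ℝ), g + Aᵀ.mulVec μ - lam = 0 ∧
      x ⬝ᵥ lam = 0 ∧ ∀ i, 0 ≤ lam i := by
  classical
  let row (j : Fin m) : (Fin n → ℝ) →ₗ[ℝ] ℝ := LinearMap.proj j ∘ₗ A.mulVecLin
  let a : Fin n ⊕ Fin m ⊕ Fin m → (Fin n → ℝ) →ₗ[ℝ] ℝ :=
    Sum.elim (fun i => if x i = 0 then LinearMap.proj i else 0) (Sum.elim row fun j => -row j)
  obtain ⟨w, hw, hc⟩ := exists_nonneg_combination_of_forall_nonneg Finset.univ a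
    (dotProductBilin ℝ ℝ g) fun d hd => by
      refine h d (funext fun j => le_antisymm ?_ ?_) fun i hi => ?_
      · simpa [a, row] using hd (Sum.inr (Sum.inr j)) (Finset.mem_univ _)
      · simpa [a, row] using hd (Sum.inr (Sum.inl j)) (Finset.mem_univ _)
      · simpa [a, hi] using hd (Sum.inl i) (Finset.mem_univ _)
  refine ⟨fun j => w (Sum.inr (Sum.inr j)) - w (Sum.inr (Sum.inl j)),
    fun i => if x i = 0 then w (Sum.inl i) else 0, funext fun i => ?_, ?_, fun i => ?_⟩
  · have hi := hc (Pi.single i 1)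
    have hproj (l : Fin n) :
        (if x l = 0 then LinearMap.proj l else (0 : (Fin n → ℝ) →ₗ[ℝ] ℝ)) (Pi.single i 1) =
          if l = i then (if x i = 0 then 1 else 0) else 0 := by
      by_cases hl : l = i
      · subst hl
        by_cases hx : x l = 0 <;> simp [hx]
      · split_ifs <;> simp [hl]
    simp only [Fintype.sum_sum_type, a, row, Sum.elim_inl, Sum.elim_inr, hproj] at hi
    simp at hi
    simp only [Pi.add_apply, Pi.sub_apply, Pi.zero_apply, mulVec, dotProduct, transpose_apply,
      hi, mul_comm (A _ i), sub_mul,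
      Finset.sum_sub_distrib]
    ring
  · refine Finset.sum_eq_zero fun i _ => ?_
    by_cases hi : x i = 0 <;> simp [hi]
  · dsimp only
    split_ifs
    exacts [hw _, le_rfl]

theorem quadratic_add_smul {n : ℕ} {H : Matrix (Fin n) (Fin n) ℝ} (hH : H.IsSymm)
    (f x d : Fin n → ℝ) (t : ℝ) :
    (1 / 2) * ((x + t • d) ⬝ᵥ H.mulVec (x + t • d)) + f ⬝ᵥ (x + t • d) =
      (1 / 2) * (x ⬝ᵥ H.mulVec x) + f ⬝ᵥ x +
        t * ((H.mulVec x + f) ⬝ᵥ d + t * ((1 / 2) * (d ⬝ᵥ H.mulVec d))) := by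
  have hsymm : x ⬝ᵥ H.mulVec d = H.mulVec x ⬝ᵥ d := by
    rw [dotProduct_mulVec, ← mulVec_transpose, hH.eq]
  simp only [mulVec_add, mulVec_smul, add_dotProduct, dotProduct_add, smul_dotProduct,
    dotProduct_smul, smul_eq_mul, hsymm, dotProduct_comm d (H.mulVec x)]
  ring

/-- First-order necessary condition for a minimizer of a quadratic function over a polyhedron. -/
theorem gradient_nonneg_of_isMinimizer {n m : ℕ} {H : Matrix (Fin n) (Fin n) ℝ} (hH : H.IsSymm)
    (f : Fin n → ℝ) (A : Matrix (Fin m) (Fin n) ℝ) (b : Fin m → ℝ) {x : Fin n → ℝ}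
    (hAx : A.mulVec x = b) (hx : ∀ i, 0 ≤ x i)
    (hmin : ∀ y, A.mulVec y = b → (∀ i, 0 ≤ y i) →
      (1 / 2) * (x ⬝ᵥ H.mulVec x) + f ⬝ᵥ x ≤ (1 / 2) * (y ⬝ᵥ H.mulVec y) + f ⬝ᵥ y)
    {d : Fin n → ℝ} (hAd : A.mulVec d = 0) (hd : ∀ i, x i = 0 → 0 ≤ d i) :
    0 ≤ (H.mulVec x + f) ⬝ᵥ d := by
  have hlim : Tendsto (fun t : ℝ => (H.mulVec x + f) ⬝ᵥ d + t * ((1 / 2) * (d ⬝ᵥ H.mulVec d)))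
      (𝓝[>] 0) (𝓝 ((H.mulVec x + f) ⬝ᵥ d)) := by
    exact tendsto_nhdsWithin_of_tendsto_nhds (Continuous.tendsto' (by fun_prop) _ _ (by simp))
  have hfeas : ∀ᶠ t : ℝ in 𝓝[>] 0, ∀ i, 0 ≤ x i + t * d i := by
    refine eventually_all.mpr fun i => ?_
    rcases (hx i).eq_or_lt with hi | hi
    · filter_upwards [self_mem_nhdsWithin] with t ht
      rw [← hi, zero_add]
      exact mul_nonneg (le_of_lt ht) (hd i hi.symm)
    · have hcont : Tendsto (fun t : ℝ => x i + t * d i) (𝓝 0) (𝓝 (x i)) :=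
        Continuous.tendsto' (by fun_prop) _ _ (by simp)
      exact nhdsWithin_le_nhds ((hcont.eventually_const_lt hi).mono fun _ => le_of_lt)
  refine ge_of_tendsto hlim ?_
  filter_upwards [hfeas, self_mem_nhdsWithin] with t ht hpos
  have hle := hmin (x + t • d) (by rw [mulVec_add, mulVec_smul, hAd, smul_zero, add_zero, hAx]) ht
  rw [quadratic_add_smul hH] at hle
  exact nonneg_of_mul_nonneg_right (by linarith) hpos

/-- At a KKT point the quadratic objective has the linear value `½·(fᵀx − bᵀμ)`. -/
theorem quadratic_eq_of_stationary {n m : ℕ} {H : Matrix (Fin n) (Fin n) ℝ}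
    {f x lam : Fin n → ℝ} {A : Matrix (Fin m) (Fin n) ℝ} {b μ : Fin m → ℝ}
    (hstat : H.mulVec x + f + Aᵀ.mulVec μ - lam = 0) (hcompl : x ⬝ᵥ lam = 0)
    (hAx : A.mulVec x = b) :
    (1 / 2) * (x ⬝ᵥ H.mulVec x) + f ⬝ᵥ x = (1 / 2) * (f ⬝ᵥ x - b ⬝ᵥ μ) := by
  have h := congrArg (x ⬝ᵥ ·) hstat
  have hμ : x ⬝ᵥ Aᵀ.mulVec μ = b ⬝ᵥ μ := by
    rw [dotProduct_mulVec, vecMul_transpose, hAx]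
  simp only [dotProduct_sub, dotProduct_add, dotProduct_zero, hcompl, hμ,
    dotProduct_comm x f] at h
  linarith

/-- If the feasible set `F = {x : Ax = b, x ≥ 0}` of (QP) is nonempty and bounded,
then the minimum of `q(x) = ½·xᵀHx + fᵀx` over `F` is attained, the set of KKT
points is nonempty, the minimum of `½·(fᵀx − bᵀμ)` over the KKT points is
attained, and the two minima coincide. -/
theorem stmt_2 {n m : ℕ} (H : Matrix (Fin n) (Fin n) ℝ) (hH : H.IsSymm)
    (f : Fin n → ℝ) (A : Matrix (Fin m) (Fin n) ℝ) (b : Fin m → ℝ)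
    (F : Set (Fin n → ℝ)) (hF : F = {x | A.mulVec x = b ∧ ∀ i, 0 ≤ x i})
    (hne : F.Nonempty) (hbdd : Bornology.IsBounded F)
    (KKT : (Fin n → ℝ) → (Fin m → ℝ) → (Fin n → ℝ) → Prop)
    (hKKT : KKT = fun x μ lam =>
      H.mulVec x + f + Aᵀ.mulVec μ - lam = 0 ∧ x ⬝ᵥ lam = 0 ∧
      A.mulVec x = b ∧ (∀ i, 0 ≤ x i) ∧ (∀ i, 0 ≤ lam i)) :
    ∃ xs ∈ F,
      (∀ y ∈ F,
        (1 / 2) * (xs ⬝ᵥ H.mulVec xs) + f ⬝ᵥ xs ≤ (1 / 2) * (y ⬝ᵥ H.mulVec y) + f ⬝ᵥ y) ∧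
      ∃ (x₀ : Fin n → ℝ) (μ₀ : Fin m → ℝ) (lam₀ : Fin n → ℝ), KKT x₀ μ₀ lam₀ ∧
        (∀ (x : Fin n → ℝ) (μ : Fin m → ℝ) (lam : Fin n → ℝ), KKT x μ lam →
          (1 / 2) * (f ⬝ᵥ x₀ - b ⬝ᵥ μ₀) ≤ (1 / 2) * (f ⬝ᵥ x - b ⬝ᵥ μ)) ∧
        (1 / 2) * (xs ⬝ᵥ H.mulVec xs) + f ⬝ᵥ xs = (1 / 2) * (f ⬝ᵥ x₀ - b ⬝ᵥ μ₀) := by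
  subst hF hKKT
  have hclosed : IsClosed {x : Fin n → ℝ | A.mulVec x = b ∧ ∀ i, 0 ≤ x i} := by
    simp only [Set.ofPred_and, Set.ofPred_forall]
    exact (isClosed_eq (by fun_prop) continuous_const).inter
      (isClosed_iInter fun i => isClosed_le continuous_const (continuous_apply i))
  obtain ⟨xs, hxs, hmin⟩ := (Metric.isCompact_of_isClosed_isBounded hclosed hbdd).exists_isMinOn hne
    (f := fun x => (1 / 2) * (x ⬝ᵥ H.mulVec x) + f ⬝ᵥ x) (by fun_prop)
  rw [isMinOn_iff] at hmin
  obtain ⟨μ, lam, hstat, hcompl, hlam⟩ :=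
    exists_multipliers_of_nonneg_on_feasible_directions A (H.mulVec xs + f) xs fun _ hAd hd =>
      gradient_nonneg_of_isMinimizer hH f A b hxs.1 hxs.2 (fun y h₁ h₂ => hmin y ⟨h₁, h₂⟩) hAd hd
  have hval := quadratic_eq_of_stationary hstat hcompl hxs.1
  refine ⟨xs, hxs, hmin, xs, μ, lam, ⟨hstat, hcompl, hxs.1, hxs.2, hlam⟩, ?_, hval⟩
  rintro x ν κ ⟨hstat', hcompl', hAx, hx, -⟩
  rw [← hval, ← quadratic_eq_of_stationary hstat' hcompl' hAx]
  exact hmin x ⟨hAx, hx⟩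
end

section
/- Let A ∈ ℝ^{m×n} and b ∈ ℝᵐ. If the set {x ∈ ℝⁿ : Ax = b, x ≥ 0} is nonempty and bounded, then the set {(x, t) ∈ ℝⁿ × ℝ : Ax = b, x + t·e ≥ 0, 0 ≤ t ≤ 1}, where e is the all-ones vector, is nonempty, closed, and bounded (hence compact). -/
open Matrix

/-- A bounded nonempty polyhedron `{x : Ax = b, x ≥ 0}` has no recession direction in the
standard simplex. -/
lemma mulVec_ne_zero_of_isBounded_polyhedron {n m : ℕ} {A : Matrix (Fin m) (Fin n) ℝ}
    {b : Fin m → ℝ}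
    (hne : {x : Fin n → ℝ | A.mulVec x = b ∧ ∀ i, 0 ≤ x i}.Nonempty)
    (hbdd : Bornology.IsBounded {x : Fin n → ℝ | A.mulVec x = b ∧ ∀ i, 0 ≤ x i})
    {d : Fin n → ℝ} (hd : d ∈ stdSimplex ℝ (Fin n)) : A.mulVec d ≠ 0 := by
  intro hAd
  obtain ⟨x, hx, hx0⟩ := hne
  obtain ⟨R, hR⟩ := hbdd.exists_norm_le
  obtain ⟨i, -, hi⟩ : ∃ i ∈ Finset.univ, 0 < d i :=
    Finset.exists_lt_of_sum_lt (by simp [hd.2])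
  have hR0 : 0 ≤ R := (norm_nonneg x).trans (hR x ⟨hx, hx0⟩)
  have hs : 0 ≤ (R + 1) / d i := by positivity
  have hmem := hR (x + ((R + 1) / d i) • d)
    ⟨by rw [mulVec_add, mulVec_smul, hAd, hx, smul_zero, add_zero],
      fun j => add_nonneg (hx0 j) (mul_nonneg hs (hd.1 j))⟩
  have hle := (le_abs_self _).trans ((norm_le_pi_norm (x + ((R + 1) / d i) • d) i).trans hmem)
  simp only [Pi.add_apply, Pi.smul_apply, smul_eq_mul, div_mul_cancel₀ _ hi.ne'] at hle
  linarith [hx0 i]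

/-- If no vector of the standard simplex is in the kernel of `A`, then `‖A y‖` bounds a multiple
of the coordinate sum on the nonnegative orthant. -/
lemma exists_mul_sum_le_norm_mulVec {n m : ℕ} {A : Matrix (Fin m) (Fin n) ℝ}
    (hA : ∀ d ∈ stdSimplex ℝ (Fin n), A.mulVec d ≠ 0) :
    ∃ c > 0, ∀ y : Fin n → ℝ, (∀ i, 0 ≤ y i) → c * ∑ i, y i ≤ ‖A.mulVec y‖ := by
  obtain ⟨c, hc, h⟩ := (isCompact_stdSimplex ℝ (Fin n)).exists_forall_le'
    (f := fun d => ‖A.mulVec d‖) (a := 0) (by fun_prop) (fun d hd => norm_pos_iff.2 (hA d hd))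
  refine ⟨c, hc, fun y hy => ?_⟩
  rcases (Finset.sum_nonneg fun i _ => hy i : 0 ≤ ∑ i, y i).eq_or_lt with h0 | h0
  · simp [← h0]
  have hmem : (∑ i, y i)⁻¹ • y ∈ stdSimplex ℝ (Fin n) :=
    ⟨fun i => mul_nonneg (inv_nonneg.2 h0.le) (hy i), by
      simp [← Finset.mul_sum, inv_mul_cancel₀ h0.ne']⟩
  have hle : c ≤ ‖A.mulVec ((∑ i, y i)⁻¹ • y)‖ := h _ hmem
  rwa [mulVec_smul, norm_smul, norm_inv, Real.norm_of_nonneg h0.le, le_inv_mul_iff₀ h0,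
    mul_comm] at hle

/-- If `{x : Ax = b, x ≥ 0}` is nonempty and bounded, then the feasible set
`{(x, t) : Ax = b, x + t·e ≥ 0, 0 ≤ t ≤ 1}` of the perturbed quadratic program
is nonempty, closed, and bounded, hence compact. -/
theorem stmt_6 {n m : ℕ} (A : Matrix (Fin m) (Fin n) ℝ) (b : Fin m → ℝ)
    (hne : {x : Fin n → ℝ | A.mulVec x = b ∧ ∀ i, 0 ≤ x i}.Nonempty)
    (hbdd : Bornology.IsBounded {x : Fin n → ℝ | A.mulVec x = b ∧ ∀ i, 0 ≤ x i})
    (S : Set ((Fin n → ℝ) × ℝ))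
    (hS : S = {p | A.mulVec p.1 = b ∧ (∀ i, 0 ≤ p.1 i + p.2) ∧ 0 ≤ p.2 ∧ p.2 ≤ 1}) :
    S.Nonempty ∧ IsClosed S ∧ Bornology.IsBounded S ∧ IsCompact S := by
  have hclosed : IsClosed S := by
    rw [hS]
    refine (isClosed_eq (by fun_prop) continuous_const).inter (IsClosed.inter ?_
      ((isClosed_le continuous_const continuous_snd).inter
        (isClosed_le continuous_snd continuous_const)))
    have hinter : IsClosed {p : (Fin n → ℝ) × ℝ | ∀ i, 0 ≤ p.1 i + p.2} := by
      rw [Set.ofPred_forall]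
      exact isClosed_iInter fun i => isClosed_le continuous_const (by fun_prop)
    exact hinter
  have hbounded : Bornology.IsBounded S := by
    obtain ⟨c, hc, h⟩ := exists_mul_sum_le_norm_mulVec
      fun d hd => mulVec_ne_zero_of_isBounded_polyhedron hne hbdd hd
    set M := ‖b‖ + ‖A.mulVec 1‖ with hM
    have hM0 : 0 ≤ M / c := by positivity
    refine isBounded_iff_forall_norm_le.2 ⟨M / c + 1, ?_⟩
    rw [hS]
    rintro ⟨x, t⟩ ⟨hx, hxt, ht0, ht1⟩
    dsimp only at hx hxt ht0 ht1
    have hy : ∀ i, 0 ≤ (x + t • (1 : Fin n → ℝ)) i := fun i => by simpa using hxt i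
    have hsum : ∑ i, (x + t • (1 : Fin n → ℝ)) i ≤ M / c := by
      rw [le_div_iff₀' hc]
      refine (h _ hy).trans ?_
      rw [mulVec_add, mulVec_smul, hx]
      refine (norm_add_le _ _).trans ?_
      rw [norm_smul, Real.norm_of_nonneg ht0, hM]
      gcongr
      exact mul_le_of_le_one_left (norm_nonneg _) ht1
    refine norm_prod_le_iff.2 ⟨(pi_norm_le_iff_of_nonneg (by positivity)).2 fun i => ?_, ?_⟩
    · have hi := (Finset.single_le_sum (fun j _ => hy j) (Finset.mem_univ i)).trans hsum
      simp only [Pi.add_apply, Pi.smul_apply, Pi.one_apply, smul_eq_mul, mul_one] at hi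
      exact abs_le.2 ⟨by linarith [hxt i], by linarith⟩
    · rw [Real.norm_of_nonneg ht0]
      linarith
  refine ⟨?_, hclosed, hbounded, Metric.isCompact_of_isClosed_isBounded hclosed hbounded⟩
  obtain ⟨x, hx, hx0⟩ := hne
  exact ⟨(x, 0), by rw [hS]; exact ⟨hx, by simpa using hx0, le_rfl, zero_le_one⟩⟩
end

section
/- Let n ≥ 1 and let Δ = {x ∈ ℝⁿ : Σᵢ xᵢ = 1, x ≥ 0} be the standard simplex. For every y ∈ ℝⁿ with Σᵢ yᵢ = 1 there exists x ∈ Δ such that ‖x − y‖_∞ ≤ (n − 1)·‖y⁻‖_∞. -/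
/-- Hoffman-type bound for the standard simplex: for `n ≥ 1`, every `y ∈ ℝⁿ`
with `∑ᵢ yᵢ = 1` is within `(n − 1)·‖y⁻‖_∞` (in the sup norm) of the standard
simplex `Δ = {x : ∑ᵢ xᵢ = 1, x ≥ 0}`. -/
theorem stmt_8 {n : ℕ} (hn : 1 ≤ n) (y : Fin n → ℝ) (hy : ∑ i, y i = 1) :
    ∃ x : Fin n → ℝ, (∑ i, x i = 1) ∧ (∀ i, 0 ≤ x i) ∧
      ‖x - y‖ ≤ ((n : ℝ) - 1) * ‖fun i => max 0 (-(y i))‖ := by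
  set z : Fin n → ℝ := fun i => max 0 (-(y i)) with hz
  have hz0 : ∀ i, 0 ≤ z i := fun i => le_max_left _ _
  have hzM : ∀ i, z i ≤ ‖z‖ := fun i => (le_abs_self _).trans (norm_le_pi_norm z i)
  have hn' : (1 : ℝ) ≤ n := by exact_mod_cast hn
  set N := ∑ i, z i with hN
  have hN0 : 0 ≤ N := Finset.sum_nonneg fun i _ => hz0 i
  have hS : (0 : ℝ) < 1 + N := by linarith
  have hp : ∀ i, 0 ≤ y i + z i := fun i => by
    have : -(y i) ≤ z i := le_max_right _ _
    linarith
  have hsum : ∑ i, (y i + z i) = 1 + N := by rw [Finset.sum_add_distrib, hy]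
  have hle : ∀ i, y i + z i ≤ 1 + N := fun i => by
    rw [← hsum]
    exact Finset.single_le_sum (f := fun i => y i + z i) (fun j _ => hp j) (Finset.mem_univ i)
  refine ⟨fun i => (y i + z i) / (1 + N), ?_, fun i => div_nonneg (hp i) hS.le, ?_⟩
  · rw [← Finset.sum_div, hsum, div_self hS.ne']
  refine (pi_norm_le_iff_of_nonneg (mul_nonneg (by linarith) (norm_nonneg _))).2 fun i => ?_
  rw [Pi.sub_apply, Real.norm_eq_abs]
  rcases le_or_gt 0 (y i) with hi | hi
  · have hzi : z i = 0 := max_eq_left (by linarith)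
    have hNM : N ≤ ((n : ℝ) - 1) * ‖z‖ := by
      have hsplit := Finset.add_sum_erase Finset.univ z (Finset.mem_univ i)
      have hcard := Finset.sum_le_card_nsmul (Finset.univ.erase i) z ‖z‖ fun j _ => hzM j
      rw [Finset.card_erase_of_mem (Finset.mem_univ i), Finset.card_univ, Fintype.card_fin,
        nsmul_eq_mul, Nat.cast_sub hn, Nat.cast_one] at hcard
      linarith
    have hyi := hle i
    rw [hzi, add_zero] at hyi
    have heq : (y i + z i) / (1 + N) - y i = -(y i / (1 + N) * N) := by
      rw [hzi]
      field_simp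
      ring
    rw [heq, abs_neg, abs_of_nonneg (by positivity)]
    exact (mul_le_of_le_one_left hN0 ((div_le_one hS).2 hyi)).trans hNM
  · have hzi : z i = -(y i) := max_eq_right (by linarith)
    have hn2 : 2 ≤ n := by
      by_contra! h
      obtain rfl : n = 1 := by omega
      rw [Subsingleton.elim i 0] at hi
      rw [Fin.sum_univ_one] at hy
      linarith
    have hn2' : (2 : ℝ) ≤ n := by exact_mod_cast hn2
    rw [hzi, add_neg_cancel, zero_div, zero_sub, ← hzi, abs_of_nonneg (hz0 i)]
    exact (hzM i).trans (le_mul_of_one_le_left (norm_nonneg _) (by linarith))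
end

section
/- Let n ≥ 2, let Δ = {x ∈ ℝⁿ : Σᵢ xᵢ = 1, x ≥ 0} be the standard simplex, and let y = (n, −1, −1, …, −1) ∈ ℝⁿ. Then Σᵢ yᵢ = 1, ‖y⁻‖_∞ = 1, and for every x ∈ Δ one has ‖x − y‖_∞ ≥ (n − 1)·‖y⁻‖_∞ = n − 1. -/
/-- Sharpness of the Hoffman-type constant `n − 1` for the standard simplex:
for `n ≥ 2` and `y = (n, −1, …, −1)`, one has `∑ᵢ yᵢ = 1`, `‖y⁻‖_∞ = 1`, and
every `x` in the standard simplex satisfies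
`‖x − y‖_∞ ≥ (n − 1)·‖y⁻‖_∞ = n − 1`. -/
theorem stmt_9 {n : ℕ} (hn : 2 ≤ n) (y : Fin n → ℝ)
    (hy : y = fun i : Fin n => if (i : ℕ) = 0 then (n : ℝ) else -1) :
    (∑ i, y i) = 1 ∧ ‖fun i => max 0 (-(y i))‖ = 1 ∧
      ∀ x : Fin n → ℝ, (∑ i, x i = 1) → (∀ i, 0 ≤ x i) →
        ((n : ℝ) - 1) * ‖fun i => max 0 (-(y i))‖ ≤ ‖x - y‖ ∧ (n : ℝ) - 1 ≤ ‖x - y‖ := by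
  obtain ⟨m, rfl⟩ : ∃ m, n = m + 2 := ⟨n - 2, by omega⟩
  have hy0 : y 0 = ((m + 2 : ℕ) : ℝ) := by simp [hy]
  have hys : ∀ i : Fin (m + 1), y i.succ = -1 := fun i => by simp [hy]
  have hnorm : ‖fun i => max 0 (-(y i))‖ = 1 := by
    apply le_antisymm
    · refine (pi_norm_le_iff_of_nonneg zero_le_one).2 fun i => ?_
      refine Fin.cases ?_ (fun j => ?_) i
      · have h : -y 0 ≤ 0 := by rw [hy0]; exact neg_nonpos.2 (Nat.cast_nonneg _)
        simp [max_eq_left h]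
      · simp [hys]
    · have h := norm_le_pi_norm (fun i => max 0 (-(y i))) (Fin.succ 0)
      simpa only [hys, neg_neg, max_eq_right zero_le_one, norm_one] using h
  refine ⟨?_, hnorm, fun x hx hx0 => ?_⟩
  · rw [Fin.sum_univ_succ, hy0]
    simp only [hys, Finset.sum_const, Finset.card_univ, Fintype.card_fin, nsmul_eq_mul]
    push_cast
    ring
  · rw [hnorm, mul_one, and_self]
    have hx1 : x 0 ≤ 1 := hx ▸ Finset.single_le_sum (fun i _ => hx0 i) (Finset.mem_univ 0)
    have h := (neg_le_abs _).trans (norm_le_pi_norm (x - y) 0)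
    rw [Pi.sub_apply, hy0] at h
    linarith
end

section
/- Let u ∈ ℝⁿ with u ≥ 0. For every pair (y, z) ∈ ℝⁿ × ℝⁿ with y + z = u there exist x, s ∈ ℝⁿ with x ≥ 0, s ≥ 0, x + s = u, and max(‖x − y‖_∞, ‖s − z‖_∞) ≤ max(‖y⁻‖_∞, ‖z⁻‖_∞). -/
/-- Hoffman-type bound for the system `x + s = u, x ≥ 0, s ≥ 0` (constraint
matrix `[I, I]`): for every `(y, z)` with `y + z = u` there exist `x, s ≥ 0`
with `x + s = u` and
`max(‖x − y‖_∞, ‖s − z‖_∞) ≤ max(‖y⁻‖_∞, ‖z⁻‖_∞)`. -/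
theorem stmt_10 {n : ℕ} (u : Fin n → ℝ) (hu : ∀ i, 0 ≤ u i)
    (y z : Fin n → ℝ) (hyz : y + z = u) :
    ∃ x s : Fin n → ℝ, (∀ i, 0 ≤ x i) ∧ (∀ i, 0 ≤ s i) ∧ x + s = u ∧
      max ‖x - y‖ ‖s - z‖ ≤
        max ‖fun i => max 0 (-(y i))‖ ‖fun i => max 0 (-(z i))‖ := by
  have hsum (i : Fin n) : 0 ≤ y i + z i := by
    simpa [← hyz] using hu i
  set a : Fin n → ℝ := fun i => max 0 (-(y i)) with ha
  set b : Fin n → ℝ := fun i => max 0 (-(z i)) with hb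
  have hab : ‖a - b‖ ≤ max ‖a‖ ‖b‖ := by
    refine (pi_norm_le_iff_of_nonneg (le_max_of_le_left (norm_nonneg a))).2 fun i => ?_
    have hai := norm_le_pi_norm a i
    have hbi := norm_le_pi_norm b i
    have ha₀ : 0 ≤ a i := le_max_left _ _
    have hb₀ : 0 ≤ b i := le_max_left _ _
    rw [Real.norm_of_nonneg ha₀] at hai
    rw [Real.norm_of_nonneg hb₀] at hbi
    rw [Pi.sub_apply, Real.norm_eq_abs]
    rcases le_total (a i) (b i) with h | h
    · rw [abs_of_nonpos (sub_nonpos.2 h)]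
      exact le_max_of_le_right (by linarith)
    · rw [abs_of_nonneg (sub_nonneg.2 h)]
      exact le_max_of_le_left (by linarith)
  refine ⟨y + (a - b), z + (b - a), fun i => ?_, fun i => ?_, ?_, ?_⟩
  · have := hsum i
    simp only [ha, hb, Pi.add_apply, Pi.sub_apply]
    grind
  · have := hsum i
    simp only [ha, hb, Pi.add_apply, Pi.sub_apply]
    grind
  · rw [← hyz]
    abel
  · rw [add_sub_cancel_left, add_sub_cancel_left, norm_sub_rev b a, max_self]
    exact hab
end

section
/- Let u ∈ ℝⁿ with u ≥ 0, and let y = −e and z = u + e, where e is the all-ones vector. Then y + z = u, max(‖y⁻‖_∞, ‖z⁻‖_∞) = 1, and for every x, s ∈ ℝⁿ with x ≥ 0, s ≥ 0, x + s = u, one has max(‖x − y‖_∞, ‖s − z‖_∞) ≥ 1. -/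
/-- Sharpness of the Hoffman-type constant `1` for the system
`x + s = u, x ≥ 0, s ≥ 0`: with `y = −e` and `z = u + e`, one has `y + z = u`,
`max(‖y⁻‖_∞, ‖z⁻‖_∞) = 1`, and every `x, s ≥ 0` with `x + s = u` satisfy
`max(‖x − y‖_∞, ‖s − z‖_∞) ≥ 1`. -/
theorem stmt_11 {n : ℕ} (hn : 1 ≤ n) (u : Fin n → ℝ) (hu : ∀ i, 0 ≤ u i)
    (y z : Fin n → ℝ) (hy : y = fun _ => -1) (hz : z = u + fun _ => 1) :
    y + z = u ∧
      max ‖fun i => max 0 (-(y i))‖ ‖fun i => max 0 (-(z i))‖ = 1 ∧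
      ∀ x s : Fin n → ℝ, (∀ i, 0 ≤ x i) → (∀ i, 0 ≤ s i) → x + s = u →
        1 ≤ max ‖x - y‖ ‖s - z‖ := by
  subst hy hz
  have : Nonempty (Fin n) := ⟨⟨0, hn⟩⟩
  refine ⟨by ext i; simp, ?_, fun x s hx _ _ => ?_⟩
  · have hy_neg : (fun _ : Fin n => max (0 : ℝ) (-(-1))) = fun _ => 1 := by
      ext i; norm_num
    have hz_neg : (fun i => max 0 (-((u + fun _ => 1 : Fin n → ℝ) i))) = 0 := by
      ext i
      have := hu i
      simp only [Pi.add_apply, Pi.zero_apply]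
      exact max_eq_left (by linarith)
    rw [hy_neg, hz_neg, pi_norm_const]
    simp
  · refine le_max_of_le_left (le_trans ?_ (norm_le_pi_norm _ ⟨0, hn⟩))
    have := hx ⟨0, hn⟩
    rw [Pi.sub_apply, Real.norm_eq_abs]
    exact le_trans (by linarith) (le_abs_self _)
end

section
/- Let H be a symmetric n×n real matrix, f ∈ ℝⁿ, A ∈ ℝ^{m×n}, b ∈ ℝᵐ, and suppose F = {x ∈ ℝⁿ : Ax = b, x ≥ 0} is nonempty and bounded. Let U ∈ ℝⁿ satisfy x ≤ U for all x ∈ F, and let V ∈ ℝⁿ be such that there exists a KKT point (x*, μ*, λ*) with x* a global minimizer of q(x) = ½·xᵀHx + fᵀx over F and λ* ≤ V. Let S be the set of tuples (x, μ, λ, z) with z ∈ {0,1}ⁿ, Hx + f + Aᵀμ − λ = 0, Ax = b, 0 ≤ xⱼ ≤ zⱼ·Uⱼ and 0 ≤ λⱼ ≤ (1 − zⱼ)·Vⱼ for all j. Then the minimum of ½·(fᵀx − bᵀμ) over S is attained and equals the minimum of q over F, and for every (x, μ, λ, z) ∈ S attaining this minimum, x is a global minimizer of q over F. -/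
open Matrix

/-- Stationarity and complementarity make the quadratic objective linear in `(x, μ)`. -/
theorem half_linear_eq_quadratic {n m : ℕ} {H : Matrix (Fin n) (Fin n) ℝ}
    {f : Fin n → ℝ} {A : Matrix (Fin m) (Fin n) ℝ} {b : Fin m → ℝ}
    {x : Fin n → ℝ} {μ : Fin m → ℝ} {l : Fin n → ℝ}
    (hstat : H.mulVec x + f + Aᵀ.mulVec μ - l = 0) (hcompl : x ⬝ᵥ l = 0)
    (hA : A.mulVec x = b) :
    (1 / 2) * (f ⬝ᵥ x - b ⬝ᵥ μ) = (1 / 2) * (x ⬝ᵥ H.mulVec x) + f ⬝ᵥ x := by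
  have h : x ⬝ᵥ (H.mulVec x + f + Aᵀ.mulVec μ - l) = 0 := by rw [hstat, dotProduct_zero]
  have hμ : x ⬝ᵥ Aᵀ.mulVec μ = b ⬝ᵥ μ := by
    rw [dotProduct_mulVec, vecMul_transpose, hA]
  rw [dotProduct_sub, dotProduct_add, dotProduct_add, hcompl, hμ, dotProduct_comm x f] at h
  linarith

/-- The big-M constraints with binary `z` force complementarity. -/
theorem dotProduct_eq_zero_of_bigM {n : ℕ} {x l z U V : Fin n → ℝ}
    (hz : ∀ j, z j = 0 ∨ z j = 1) (hx : ∀ j, 0 ≤ x j ∧ x j ≤ z j * U j)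
    (hl : ∀ j, 0 ≤ l j ∧ l j ≤ (1 - z j) * V j) : x ⬝ᵥ l = 0 := by
  refine Finset.sum_eq_zero fun j _ => ?_
  obtain ⟨hx0, hxU⟩ := hx j
  obtain ⟨hl0, hlV⟩ := hl j
  rcases hz j with h | h
  · rw [h, zero_mul] at hxU
    rw [le_antisymm hxU hx0, zero_mul]
  · rw [h, sub_self, zero_mul] at hlV
    rw [le_antisymm hlV hl0, mul_zero]

/-- Complementary nonnegative vectors bounded by `U` and `V` satisfy the big-M constraints
for some binary `z`. -/
theorem exists_bigM_of_dotProduct_eq_zero {n : ℕ} {x l U V : Fin n → ℝ}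
    (hx : ∀ j, 0 ≤ x j) (hl : ∀ j, 0 ≤ l j) (hcompl : x ⬝ᵥ l = 0)
    (hU : ∀ j, x j ≤ U j) (hV : ∀ j, l j ≤ V j) :
    ∃ z : Fin n → ℝ, (∀ j, z j = 0 ∨ z j = 1) ∧ (∀ j, 0 ≤ x j ∧ x j ≤ z j * U j) ∧
      ∀ j, 0 ≤ l j ∧ l j ≤ (1 - z j) * V j := by
  have hmul : ∀ j, x j * l j = 0 := fun j =>
    (Finset.sum_eq_zero_iff_of_nonneg fun i _ => mul_nonneg (hx i) (hl i)).1 hcompl j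
      (Finset.mem_univ j)
  have hex : ∀ j, ∃ z : ℝ, (z = 0 ∨ z = 1) ∧ (0 ≤ x j ∧ x j ≤ z * U j) ∧
      (0 ≤ l j ∧ l j ≤ (1 - z) * V j) := by
    intro j
    rcases mul_eq_zero.1 (hmul j) with h | h
    · exact ⟨0, Or.inl rfl, ⟨hx j, by simp [h]⟩, hl j, by simpa using hV j⟩
    · exact ⟨1, Or.inr rfl, ⟨hx j, by simpa using hU j⟩, hl j, by simp [h]⟩
  choose z hz using hex
  exact ⟨z, fun j => (hz j).1, fun j => (hz j).2.1, fun j => (hz j).2.2⟩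

/-- Correctness of the MILP reformulation (IQP) of (QP): if `F = {x : Ax = b, x ≥ 0}`
is nonempty and bounded, `U` bounds `F` componentwise, and `V` bounds the dual
variables of some optimal KKT point, then the minimum of `½·(fᵀx − bᵀμ)` over the
feasible set `S` of (IQP) is attained and equals the minimum of
`q(x) = ½·xᵀHx + fᵀx` over `F`, and the `x`-part of any minimizer of (IQP) is a
global minimizer of `q` over `F`. -/
theorem stmt_14 {n m : ℕ} (H : Matrix (Fin n) (Fin n) ℝ) (hH : H.IsSymm)
    (f : Fin n → ℝ) (A : Matrix (Fin m) (Fin n) ℝ) (b : Fin m → ℝ)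
    (F : Set (Fin n → ℝ)) (hF : F = {x | A.mulVec x = b ∧ ∀ i, 0 ≤ x i})
    (hne : F.Nonempty) (hbdd : Bornology.IsBounded F)
    (U : Fin n → ℝ) (hU : ∀ x ∈ F, ∀ j, x j ≤ U j)
    (V : Fin n → ℝ)
    (hV : ∃ (xs : Fin n → ℝ) (μs : Fin m → ℝ) (lams : Fin n → ℝ),
      (H.mulVec xs + f + Aᵀ.mulVec μs - lams = 0 ∧ xs ⬝ᵥ lams = 0 ∧
        A.mulVec xs = b ∧ (∀ i, 0 ≤ xs i) ∧ (∀ i, 0 ≤ lams i)) ∧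
      (∀ y ∈ F,
        (1 / 2) * (xs ⬝ᵥ H.mulVec xs) + f ⬝ᵥ xs ≤ (1 / 2) * (y ⬝ᵥ H.mulVec y) + f ⬝ᵥ y) ∧
      (∀ j, lams j ≤ V j))
    (S : Set ((Fin n → ℝ) × (Fin m → ℝ) × (Fin n → ℝ) × (Fin n → ℝ)))
    (hS : S = {p | (∀ j, p.2.2.2 j = 0 ∨ p.2.2.2 j = 1) ∧
      H.mulVec p.1 + f + Aᵀ.mulVec p.2.1 - p.2.2.1 = 0 ∧
      A.mulVec p.1 = b ∧
      (∀ j, 0 ≤ p.1 j ∧ p.1 j ≤ p.2.2.2 j * U j) ∧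
      (∀ j, 0 ≤ p.2.2.1 j ∧ p.2.2.1 j ≤ (1 - p.2.2.2 j) * V j)}) :
    (∃ p ∈ S, (∀ q ∈ S, (1 / 2) * (f ⬝ᵥ p.1 - b ⬝ᵥ p.2.1) ≤ (1 / 2) * (f ⬝ᵥ q.1 - b ⬝ᵥ q.2.1)) ∧
      ∃ xs ∈ F, (∀ y ∈ F,
          (1 / 2) * (xs ⬝ᵥ H.mulVec xs) + f ⬝ᵥ xs ≤
            (1 / 2) * (y ⬝ᵥ H.mulVec y) + f ⬝ᵥ y) ∧
        (1 / 2) * (f ⬝ᵥ p.1 - b ⬝ᵥ p.2.1) = (1 / 2) * (xs ⬝ᵥ H.mulVec xs) + f ⬝ᵥ xs) ∧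
    ∀ p ∈ S, (∀ q ∈ S, (1 / 2) * (f ⬝ᵥ p.1 - b ⬝ᵥ p.2.1) ≤ (1 / 2) * (f ⬝ᵥ q.1 - b ⬝ᵥ q.2.1)) →
      p.1 ∈ F ∧ ∀ y ∈ F,
        (1 / 2) * (p.1 ⬝ᵥ H.mulVec p.1) + f ⬝ᵥ p.1 ≤ (1 / 2) * (y ⬝ᵥ H.mulVec y) + f ⬝ᵥ y := by
  subst hF hS
  obtain ⟨xs, μs, ls, ⟨hstat, hcompl, hA, hx, hl⟩, hmin, hlV⟩ := hV
  obtain ⟨z, hz, hxz, hlz⟩ :=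
    exists_bigM_of_dotProduct_eq_zero hx hl hcompl (hU xs ⟨hA, hx⟩) hlV
  have hobj := half_linear_eq_quadratic hstat hcompl hA
  refine ⟨⟨(xs, μs, ls, z), ⟨hz, hstat, hA, hxz, hlz⟩, ?_, xs, ⟨hA, hx⟩, hmin, hobj⟩, ?_⟩
  · rintro ⟨x, μ, l, w⟩ ⟨hw, hs, hAx, hxw, hlw⟩
    have hq := half_linear_eq_quadratic hs (dotProduct_eq_zero_of_bigM hw hxw hlw) hAx
    exact (hobj.trans_le (hmin x ⟨hAx, fun i => (hxw i).1⟩)).trans_eq hq.symm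
  · rintro ⟨x, μ, l, w⟩ ⟨hw, hs, hAx, hxw, hlw⟩ hopt
    have hq := half_linear_eq_quadratic hs (dotProduct_eq_zero_of_bigM hw hxw hlw) hAx
    have hle := hopt (xs, μs, ls, z) ⟨hz, hstat, hA, hxz, hlz⟩
    exact ⟨⟨hAx, fun i => (hxw i).1⟩, fun y hy =>
      (hq.symm.trans_le (hle.trans_eq hobj)).trans (hmin y hy)⟩
end

section
/- Let G be a finite simple graph on vertex set {1, …, n} with n ≥ 1, let A be its adjacency matrix, let I be the n×n identity matrix, and let α(G) denote the stability (independence) number of G. Then the minimum of xᵀ(A + I)x over the standard simplex Δ = {x ∈ ℝⁿ : Σᵢ xᵢ = 1, x ≥ 0} is attained and equals 1/α(G). -/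
open Matrix

namespace Matrix

variable {ι R : Type*} [Fintype ι]

/-- Expansion of a symmetric quadratic form along a line. -/
theorem IsSymm.dotProduct_mulVec_add_smul [CommRing R] {B : Matrix ι ι R} (hB : B.IsSymm)
    (y d : ι → R) (t : R) :
    (y + t • d) ⬝ᵥ B *ᵥ (y + t • d) =
      y ⬝ᵥ B *ᵥ y + 2 * t * (d ⬝ᵥ B *ᵥ y) + t ^ 2 * (d ⬝ᵥ B *ᵥ d) := by
  have h : y ⬝ᵥ B *ᵥ d = d ⬝ᵥ B *ᵥ y := by
    rw [dotProduct_mulVec, ← mulVec_transpose, hB.eq, dotProduct_comm]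
  simp only [mulVec_add, mulVec_smul, add_dotProduct, dotProduct_add, smul_dotProduct,
    dotProduct_smul, smul_eq_mul, h]
  ring

end Matrix

namespace SimpleGraph

variable {V : Type*} [Fintype V] [DecidableEq V] (G : SimpleGraph V) [DecidableRel G.Adj]

theorem dotProduct_adjMatrix_add_one_mulVec (y : V → ℝ) :
    y ⬝ᵥ (G.adjMatrix ℝ + 1) *ᵥ y =
      ∑ i, ∑ j, (if G.Adj i j then y i * y j else 0) + ∑ i, y i ^ 2 := by
  simp only [add_mulVec, one_mulVec, dotProduct_add]
  congr 1
  · simp [dotProduct, mulVec, Finset.mul_sum]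
  · simp [dotProduct, sq]

/-- Mass can be moved along an edge so that one endpoint leaves the support, without increasing
the quadratic form of `A + I`. -/
theorem exists_support_ssubset_of_adj {y : V → ℝ} (hy : ∀ i, 0 ≤ y i) {i j : V}
    (hij : G.Adj i j) (hi : y i ≠ 0) (hj : y j ≠ 0) :
    ∃ z : V → ℝ, (∀ k, 0 ≤ z k) ∧ ∑ k, z k = ∑ k, y k ∧
      Finset.univ.filter (z · ≠ 0) ⊂ Finset.univ.filter (y · ≠ 0) ∧
      z ⬝ᵥ (G.adjMatrix ℝ + 1) *ᵥ z ≤ y ⬝ᵥ (G.adjMatrix ℝ + 1) *ᵥ y := by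
  wlog h : ((G.adjMatrix ℝ + 1) *ᵥ y) i ≤ ((G.adjMatrix ℝ + 1) *ᵥ y) j generalizing i j
  · exact this hij.symm hj hi (le_of_not_ge h)
  have hne : i ≠ j := hij.ne
  set B := G.adjMatrix ℝ + 1 with hBdef
  have hB : B.IsSymm := by
    rw [hBdef]
    exact G.isSymm_adjMatrix.add isSymm_one
  set d : V → ℝ := Pi.single i 1 - Pi.single j 1 with hd
  have hdy : d ⬝ᵥ B *ᵥ y = (B *ᵥ y) i - (B *ᵥ y) j := by
    simp [hd, sub_dotProduct]
  have hdd : d ⬝ᵥ B *ᵥ d = 0 := by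
    simp [hd, sub_dotProduct, mulVec_sub, hBdef, hij, hij.symm, hne, hne.symm]
  refine ⟨y + y j • d, fun k ↦ ?_, ?_, ?_, ?_⟩
  · have := hy k
    have := hy j
    rcases eq_or_ne k j with rfl | hkj
    · simp [hd, hne.symm]
    · rcases eq_or_ne k i with rfl | hki
      · simp [hd, hkj]; linarith
      · simp [hd, hkj, hki, hy k]
  · simp [Finset.sum_add_distrib, hd, ← Finset.mul_sum]
  · rw [Finset.ssubset_iff_of_subset]
    · exact ⟨j, by simpa using hj, by simp [hd, hne.symm]⟩
    · intro k
      simp only [Finset.mem_filter_univ]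
      contrapose
      intro hk
      have hki : k ≠ i := fun h ↦ hi (h ▸ hk)
      have hkj : k ≠ j := fun h ↦ hj (h ▸ hk)
      simp [hd, hki, hkj, hk]
  · rw [hB.dotProduct_mulVec_add_smul, hdd, hdy]
    nlinarith [hy j]

/-- The Motzkin–Straus inequality in homogeneous form. -/
theorem sq_sum_le_indepNum_mul (y : V → ℝ) (hy : ∀ i, 0 ≤ y i) :
    (∑ i, y i) ^ 2 ≤ G.indepNum * (y ⬝ᵥ (G.adjMatrix ℝ + 1) *ᵥ y) := by
  induction hs : ({k | y k ≠ 0} : Finset V) using Finset.strongInduction generalizing y with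
  | H s ih =>
    subst hs
    by_cases hI : G.IsIndepSet (({k | y k ≠ 0} : Finset V) : Set V)
    · have hsum : ∑ i, y i = ∑ i with y i ≠ 0, y i := (Finset.sum_filter_ne_zero _).symm
      rw [hsum]
      refine sq_sum_le_card_mul_sum_sq.trans ?_
      have hcard := hI.card_le_indepNum
      refine mul_le_mul (by exact_mod_cast hcard) ?_ (by positivity) (by positivity)
      rw [dotProduct_adjMatrix_add_one_mulVec]
      have h1 : 0 ≤ ∑ i, ∑ j, (if G.Adj i j then y i * y j else 0) := by
        refine Finset.sum_nonneg fun i _ ↦ Finset.sum_nonneg fun j _ ↦ ?_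
        split_ifs
        exacts [mul_nonneg (hy i) (hy j), le_rfl]
      have h2 : ∑ i with y i ≠ 0, y i ^ 2 ≤ ∑ i, y i ^ 2 :=
        Finset.sum_le_sum_of_subset_of_nonneg (Finset.filter_subset _ _)
          fun i _ _ ↦ sq_nonneg _
      linarith
    · simp only [IsIndepSet, Set.Pairwise, not_forall, not_not] at hI
      obtain ⟨i, hi, j, hj, -, hij⟩ := hI
      obtain ⟨z, hz, hsum, hlt, hle⟩ :=
        G.exists_support_ssubset_of_adj hy hij (by simpa using hi) (by simpa using hj)
      rw [← hsum]
      exact (ih _ hlt z hz rfl).trans (mul_le_mul_of_nonneg_left hle (Nat.cast_nonneg _))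

variable {G} in
/-- The value of the quadratic form of `A + I` at the barycenter of an independent set. -/
theorem IsIndepSet.dotProduct_adjMatrix_add_one_mulVec_barycenter {s : Finset V}
    (hs : G.IsIndepSet (s : Set V)) :
    (fun i ↦ if i ∈ s then 1 / (s.card : ℝ) else 0) ⬝ᵥ
      (G.adjMatrix ℝ + 1) *ᵥ (fun i ↦ if i ∈ s then 1 / (s.card : ℝ) else 0) =
        1 / (s.card : ℝ) := by
  rw [dotProduct_adjMatrix_add_one_mulVec, Finset.sum_eq_zero, zero_add]
  · rcases eq_or_ne (s.card : ℝ) 0 with h | h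
    · simp [h]
    · simp only [ite_pow, ne_eq, OfNat.ofNat_ne_zero, not_false_eq_true, zero_pow,
        Finset.sum_ite_mem, Finset.univ_inter, Finset.sum_const, nsmul_eq_mul]
      field_simp
  · refine fun i _ ↦ Finset.sum_eq_zero fun j _ ↦ ?_
    split_ifs with hij hi hj
    · exact absurd hij (hs hi hj hij.ne)
    all_goals simp

end SimpleGraph

/-- Motzkin–Straus theorem: for a finite simple graph `G` on `n ≥ 1` vertices
with adjacency matrix `A` and stability (independence) number `α`, the minimum
of `xᵀ(A + I)x` over the standard simplex `Δ = {x : ∑ᵢ xᵢ = 1, x ≥ 0}` is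
attained and equals `1/α`. -/
theorem stmt_15 {n : ℕ} (hn : 1 ≤ n) (G : SimpleGraph (Fin n)) [DecidableRel G.Adj]
    (α : ℕ)
    (hα : α = sSup {k : ℕ | ∃ s : Finset (Fin n),
      (∀ i ∈ s, ∀ j ∈ s, i ≠ j → ¬ G.Adj i j) ∧ s.card = k}) :
    ∃ x : Fin n → ℝ, (∑ i, x i = 1) ∧ (∀ i, 0 ≤ x i) ∧
      x ⬝ᵥ (G.adjMatrix ℝ + 1).mulVec x = 1 / (α : ℝ) ∧
      ∀ y : Fin n → ℝ, (∑ i, y i = 1) → (∀ i, 0 ≤ y i) →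
        x ⬝ᵥ (G.adjMatrix ℝ + 1).mulVec x ≤ y ⬝ᵥ (G.adjMatrix ℝ + 1).mulVec y := by
  have hα' : α = G.indepNum := by
    rw [hα, SimpleGraph.indepNum]
    simp only [SimpleGraph.isNIndepSet_iff, SimpleGraph.IsIndepSet, Set.Pairwise, SetLike.mem_coe]
  subst hα'
  clear hα
  obtain ⟨s, hs, hcard⟩ := G.exists_isNIndepSet_indepNum
  have hpos : 0 < (G.indepNum : ℝ) := by
    have h : G.IsIndepSet (({⟨0, hn⟩} : Finset (Fin n)) : Set (Fin n)) := by
      simp [SimpleGraph.IsIndepSet]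
    exact_mod_cast h.card_le_indepNum
  have hval := hs.dotProduct_adjMatrix_add_one_mulVec_barycenter
  rw [hcard] at hval
  refine ⟨_, ?_, fun i ↦ ?_, hval, fun y hy1 hy0 ↦ ?_⟩
  · simp [hcard, hpos.ne']
  · split_ifs <;> positivity
  · rw [hval, div_le_iff₀' hpos]
    simpa [hy1] using G.sq_sum_le_indepNum_mul y hy0
end
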